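/- arXiv:2104.14355 — 2 statements merged into one kernel-verified Lean document; each statement's English description precedes it below -/
import Mathlib

section
/- Let Λ be a measurable space, let μ₀ and μ₁ be probability measures on Λ, and let Ω₀ and Ω₁ be measurable subsets of Λ such that either Ω₀ ∩ Ω₁ = ∅ or Ω₀ = Ω₁. Define the success probability P_S = (1/4)·(μ₀(Ω₀) + μ₁(Ω₀) + μ₀(Ω₁) + (1 − μ₁(Ω₁))). Then P_S ≤ 3/4. -/
open MeasureTheory

/-- Main theorem: for any ontological model satisfying no overlap and strong duality,
the success probability `P_S = (1/4)(μ₀(Ω₀) + μ₁(Ω₀) + μ₀(Ω₁) + (1 − μ₁(Ω₁)))`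
of the operational task is at most `3/4`. -/
theorem universal_classicality_bound {Λ : Type*} [MeasurableSpace Λ]
    (μ₀ μ₁ : Measure Λ) [IsProbabilityMeasure μ₀] [IsProbabilityMeasure μ₁]
    (Ω₀ Ω₁ : Set Λ) (hΩ₀ : MeasurableSet Ω₀) (hΩ₁ : MeasurableSet Ω₁)
    (h : Ω₀ ∩ Ω₁ = ∅ ∨ Ω₀ = Ω₁) :
    (1 / 4 : ℝ) * ((μ₀ Ω₀).toReal + (μ₁ Ω₀).toReal + (μ₀ Ω₁).toReal
      + (1 - (μ₁ Ω₁).toReal)) ≤ 3 / 4 := by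
  simp only [← measureReal_def]
  rcases h with h | rfl
  · have hadd : μ₀.real Ω₀ + μ₀.real Ω₁ ≤ 1 := by
      rw [← measureReal_union (Set.disjoint_iff_inter_eq_empty.mpr h) hΩ₁]
      exact measureReal_le_one
    have h₁ : μ₁.real Ω₀ ≤ 1 := measureReal_le_one
    have h₂ : 0 ≤ μ₁.real Ω₁ := measureReal_nonneg
    linarith
  · have h₀ : μ₀.real Ω₀ ≤ 1 := measureReal_le_one
    linarith
end

section
/- Let (Λ, ν) be a measure space and let f : Fin n → Λ → ℝ≥0 be measurable functions with ∫ f_i dν = 1 for each i, whose supports are pairwise disjoint up to ν-null sets (i.e., f_i·f_j = 0 ν-almost everywhere for i ≠ j). Let z : Fin n → Fin m → ℝ≥0 (with m ≥ 1) be coefficients satisfying Σᵢ z_{i,x} = 1 for each x ∈ Fin m. Then ∫_Λ (max over x ∈ Fin m of Σᵢ z_{i,x}·f_i(λ)) dν(λ) = Σᵢ (max over x ∈ Fin m of z_{i,x}). -/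
open MeasureTheory

/-- If at most one of the weights `g i` is nonzero, then the supremum of a weighted sum is the
weighted sum of the suprema. -/
theorem ENNReal.iSup_sum_mul_of_pairwise_mul_eq_zero {ι κ : Type*} [Fintype ι]
    (a : ι → κ → ENNReal) (g : ι → ENNReal) (hg : ∀ i j, i ≠ j → g i * g j = 0) :
    ⨆ x, ∑ i, a i x * g i = ∑ i, (⨆ x, a i x) * g i := by
  by_cases h : ∃ i, g i ≠ 0
  · obtain ⟨i, hi⟩ := h
    have hj : ∀ j, j ≠ i → g j = 0 := fun j hji =>
      (mul_eq_zero.mp (hg j i hji)).resolve_right hi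
    have hsum (b : ι → ENNReal) : ∑ j, b j * g j = b i * g i :=
      Fintype.sum_eq_single i fun j hji => by rw [hj j hji, mul_zero]
    simp only [hsum]
    exact (ENNReal.iSup_mul ..).symm
  · push Not at h
    simp [h]

/-- Key computation in the proof that universal classicality plus convexity implies
bounded ontological distinctness: for normalized densities `f i` with pairwise (a.e.)
disjoint supports and mixtures `μ(·|P_x) = Σᵢ z_{i,x} fᵢ`,
`∫ max_x Σᵢ z_{i,x} fᵢ dν = Σᵢ max_x z_{i,x}`. -/
theorem ontological_distinguishability_eq
    {Λ : Type*} [MeasurableSpace Λ] (ν : Measure Λ) {n m : ℕ} (hm : 1 ≤ m)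
    (f : Fin n → Λ → NNReal) (hf : ∀ i, Measurable (f i))
    (hnorm : ∀ i, ∫⁻ ω, (f i ω : ENNReal) ∂ν = 1)
    (hdisj : ∀ i j, i ≠ j → ∀ᵐ ω ∂ν, f i ω * f j ω = 0)
    (z : Fin n → Fin m → NNReal) (hz : ∀ x, ∑ i, z i x = 1) :
    ∫⁻ ω, (⨆ x : Fin m, ∑ i, (z i x : ENNReal) * f i ω) ∂ν
      = ∑ i, ⨆ x : Fin m, (z i x : ENNReal) := by
  have hdisj' : ∀ᵐ ω ∂ν, ∀ i j, i ≠ j → f i ω * f j ω = 0 := by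
    simpa only [ae_all_iff] using hdisj
  have hpt : ∀ᵐ ω ∂ν, ⨆ x : Fin m, ∑ i, (z i x : ENNReal) * f i ω
      = ∑ i, (⨆ x : Fin m, (z i x : ENNReal)) * f i ω := by
    filter_upwards [hdisj'] with ω hω
    exact ENNReal.iSup_sum_mul_of_pairwise_mul_eq_zero (fun i x => (z i x : ENNReal))
      (fun i => (f i ω : ENNReal)) fun i j hij => by exact_mod_cast hω i j hij
  rw [lintegral_congr_ae hpt,
    lintegral_finsetSum _ fun i _ => (hf i).coe_nnreal_ennreal.const_mul _]
  refine Finset.sum_congr rfl fun i _ => ?_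
  rw [lintegral_const_mul _ (hf i).coe_nnreal_ennreal, hnorm i, mul_one]
end
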